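/- Second escort-moment identity for the q-Gaussian: let d ≥ 1 be an integer, λ > 0, and 1 ≤ q < min{(dλ+1)/(dλ), (d+4)/(d+2)}. Set s₂ = 1 + 2λ(q-1) and q' = [s₂-(1-q)]/s₂. Then (2_{q'd} (2_{qd} π_{qd})^{λd(q-1)} / 2_{qd}) · (π_{qd}/π_{q'd})^{d/2} · s₂^{(d+2)/2} · ∫_{ℝ^d} [G_q(x;0,I_d)]^{s₂} x xᵀ dx = I_d, where I_d is the d×d identity matrix. -/

import Mathlib

open MeasureTheory Real Matrix

/-- The real `q`-exponential. -/
noncomputable def qExp (q u : ℝ) : ℝ :=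
  if q = 1 then Real.exp u
  else if 0 < 1 + (1 - q) * u then (1 + (1 - q) * u) ^ (1 / (1 - q)) else 0

/-- `π_{qd} = (∫_{ℝ^d} exp_q(-‖x‖²) dx)^{2/d}`. -/
noncomputable def piQd (q : ℝ) (d : ℕ) : ℝ :=
  (∫ x : EuclideanSpace ℝ (Fin d), qExp q (-‖x‖ ^ 2)) ^ (2 / (d : ℝ))

/-- `2_{qd} = d π_{qd}^{d/2} / ∫_{ℝ^d} ‖x‖² exp_q(-‖x‖²) dx`. -/
noncomputable def twoQd (q : ℝ) (d : ℕ) : ℝ :=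
  d * piQd q d ^ ((d : ℝ) / 2) /
    ∫ x : EuclideanSpace ℝ (Fin d), ‖x‖ ^ 2 * qExp q (-‖x‖ ^ 2)

/-- The q-Gaussian density with identity covariance:
`G_q(x;0,I_d) = exp_q(-‖x‖²/2_{qd}) / (2_{qd}π_{qd})^{d/2}`. -/
noncomputable def GqId (q : ℝ) (d : ℕ) (x : EuclideanSpace ℝ (Fin d)) : ℝ :=
  qExp q (-(‖x‖ ^ 2 / twoQd q d)) / (twoQd q d * piQd q d) ^ ((d : ℝ) / 2)

section QExp

variable {q : ℝ}

lemma qExp_neg_eq_rpow (hq : 1 < q) {y : ℝ} (hy : 0 ≤ y) :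
    qExp q (-y) = (1 + (q - 1) * y) ^ (-(1 / (q - 1))) := by
  have h : 0 < 1 + (q - 1) * y := by nlinarith
  have e : 1 + (1 - q) * -y = 1 + (q - 1) * y := by ring
  have e' : 1 / (1 - q) = -(1 / (q - 1)) := by
    rw [← neg_sub q 1, one_div_neg_eq_neg_one_div]
  rw [qExp, if_neg hq.ne', e, if_pos h, e']

lemma qExp_neg_pos (hq : 1 ≤ q) {y : ℝ} (hy : 0 ≤ y) : 0 < qExp q (-y) := by
  rcases hq.eq_or_lt with rfl | hq
  · simp [qExp, Real.exp_pos]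
  · rw [qExp_neg_eq_rpow hq hy]
    exact Real.rpow_pos_of_pos (by nlinarith) _

lemma exp_neg_le_qExp_neg (hq : 1 < q) {y : ℝ} (hy : 0 ≤ y) :
    Real.exp (-y) ≤ qExp q (-y) := by
  have h0 : 0 < q - 1 := by linarith
  have h : 1 + (q - 1) * y ≤ Real.exp ((q - 1) * y) := by
    linarith [Real.add_one_le_exp ((q - 1) * y)]
  have hpos : 0 < 1 + (q - 1) * y := by nlinarith
  rw [qExp_neg_eq_rpow hq hy]
  calc Real.exp (-y) = Real.exp ((q - 1) * y) ^ (-(1 / (q - 1))) := by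
        rw [← Real.exp_mul]; congr 1; field_simp
    _ ≤ _ := Real.rpow_le_rpow_of_nonpos hpos h (by
        rw [neg_nonpos]; positivity)

/-- Powers of the `q`-exponential are `q'`-exponentials with `q' = 1 + (q - 1) / s`. -/
lemma qExp_neg_rpow (hq : 1 ≤ q) {s : ℝ} (hs : 0 < s) {y : ℝ} (hy : 0 ≤ y) :
    qExp q (-y) ^ s = qExp (1 + (q - 1) / s) (-(s * y)) := by
  rcases hq.eq_or_lt with rfl | hq
  · simp [qExp, ← Real.exp_mul, mul_comm]
  · have h0 : 0 < q - 1 := by linarith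
    have hq' : 1 < 1 + (q - 1) / s := by
      have : 0 < (q - 1) / s := by positivity
      linarith
    rw [qExp_neg_eq_rpow hq hy, qExp_neg_eq_rpow hq' (by positivity),
      ← Real.rpow_mul (by positivity)]
    congr 1
    · field_simp; ring
    · rw [add_sub_cancel_left]; field_simp

variable {E : Type*} [NormedAddCommGroup E]

lemma continuous_qExp_neg_norm_sq (hq : 1 ≤ q) :
    Continuous fun x : E => qExp q (-‖x‖ ^ 2) := by
  rcases hq.eq_or_lt with rfl | hq
  · simp only [qExp, if_true]; fun_prop
  · simp only [qExp_neg_eq_rpow hq (sq_nonneg _)]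
    refine Continuous.rpow_const (by fun_prop) fun x => Or.inl ?_
    have : 0 ≤ (q - 1) * ‖x‖ ^ 2 := mul_nonneg (by linarith) (sq_nonneg _)
    positivity

variable [NormedSpace ℝ E] [FiniteDimensional ℝ E] [MeasurableSpace E] [BorelSpace E]
  (μ : Measure E) [μ.IsAddHaarMeasure]

lemma integrable_one_add_norm_sq_mul_qExp_of_one_lt (hq : 1 < q)
    (hq2 : (q - 1) * (Module.finrank ℝ E + 2) < 2) :
    Integrable (fun x : E => (1 + ‖x‖ ^ 2) * qExp q (-‖x‖ ^ 2)) μ := by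
  have h0 : 0 < q - 1 := by linarith
  set a : ℝ := √(q - 1)
  have ha : a ^ 2 = q - 1 := Real.sq_sqrt h0.le
  have ha0 : a ≠ 0 := (Real.sqrt_pos.2 h0).ne'
  have hr : (Module.finrank ℝ E : ℝ) < 2 * (1 / (q - 1) - 1) := by
    have : ((Module.finrank ℝ E : ℝ) + 2) < 2 / (q - 1) := by
      rw [lt_div_iff₀ h0]; linarith
    have e : 2 / (q - 1) = 2 * (1 / (q - 1)) := by ring
    linarith
  have hI := ((integrable_rpow_neg_one_add_norm_sq (μ := μ) hr).comp_smul ha0).const_mul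
    (1 + 1 / (q - 1))
  refine hI.mono' ?_ (Filter.Eventually.of_forall fun x => ?_)
  · exact (Continuous.mul (by fun_prop)
      (continuous_qExp_neg_norm_sq hq.le)).aestronglyMeasurable
  · have hx : (0 : ℝ) ≤ ‖x‖ ^ 2 := sq_nonneg _
    have hpos : 0 < 1 + (q - 1) * ‖x‖ ^ 2 := by positivity
    rw [Real.norm_of_nonneg (mul_nonneg (by positivity) (qExp_neg_pos hq.le hx).le),
      qExp_neg_eq_rpow hq hx, norm_smul, mul_pow, Real.norm_eq_abs, sq_abs, ha]
    have e : -(2 * (1 / (q - 1) - 1)) / 2 = 1 + -(1 / (q - 1)) := by ring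
    rw [e, Real.rpow_add hpos, Real.rpow_one, ← mul_assoc]
    refine mul_le_mul_of_nonneg_right ?_ (Real.rpow_nonneg hpos.le _)
    have : (1 + 1 / (q - 1)) * (1 + (q - 1) * ‖x‖ ^ 2)
      = 1 + ‖x‖ ^ 2 + (1 / (q - 1) + (q - 1) * ‖x‖ ^ 2) := by field_simp; ring
    rw [this]
    have : 0 ≤ 1 / (q - 1) + (q - 1) * ‖x‖ ^ 2 := by positivity
    linarith

lemma integrable_one_add_norm_sq_mul_qExp (hq : 1 ≤ q)
    (hq2 : (q - 1) * (Module.finrank ℝ E + 2) < 2) :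
    Integrable (fun x : E => (1 + ‖x‖ ^ 2) * qExp q (-‖x‖ ^ 2)) μ := by
  rcases hq.eq_or_lt with rfl | hq
  · have hn : (0 : ℝ) < Module.finrank ℝ E + 2 := by positivity
    set r : ℝ := 1 + 1 / (Module.finrank ℝ E + 2)
    have hr : 1 < r := by
      have : (0 : ℝ) < 1 / (Module.finrank ℝ E + 2) := by positivity
      simp only [r]; linarith
    have hr2 : (r - 1) * (Module.finrank ℝ E + 2) < 2 := by
      simp only [r, add_sub_cancel_left]
      rw [one_div_mul_cancel hn.ne']; norm_num
    refine (integrable_one_add_norm_sq_mul_qExp_of_one_lt μ hr hr2).mono' ?_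
      (Filter.Eventually.of_forall fun x => ?_)
    · exact (Continuous.mul (by fun_prop)
        (continuous_qExp_neg_norm_sq le_rfl)).aestronglyMeasurable
    · have hx : (0 : ℝ) ≤ ‖x‖ ^ 2 := sq_nonneg _
      rw [Real.norm_of_nonneg (mul_nonneg (by positivity) (qExp_neg_pos le_rfl hx).le)]
      refine mul_le_mul_of_nonneg_left ?_ (by positivity)
      simpa [qExp] using exp_neg_le_qExp_neg hr hx
  · exact integrable_one_add_norm_sq_mul_qExp_of_one_lt μ hq hq2

lemma integrable_qExp_neg_norm_sq (hq : 1 ≤ q)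
    (hq2 : (q - 1) * (Module.finrank ℝ E + 2) < 2) :
    Integrable (fun x : E => qExp q (-‖x‖ ^ 2)) μ := by
  refine (integrable_one_add_norm_sq_mul_qExp μ hq hq2).mono'
    (continuous_qExp_neg_norm_sq hq).aestronglyMeasurable
    (Filter.Eventually.of_forall fun x => ?_)
  have h := (qExp_neg_pos hq (sq_nonneg ‖x‖)).le
  rw [Real.norm_of_nonneg h]
  nlinarith [mul_nonneg (sq_nonneg ‖x‖) h]

lemma integrable_norm_sq_mul_qExp (hq : 1 ≤ q)
    (hq2 : (q - 1) * (Module.finrank ℝ E + 2) < 2) :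
    Integrable (fun x : E => ‖x‖ ^ 2 * qExp q (-‖x‖ ^ 2)) μ := by
  convert (integrable_one_add_norm_sq_mul_qExp μ hq hq2).sub
    (integrable_qExp_neg_norm_sq μ hq hq2) using 2
  simp only [Pi.sub_apply]
  ring

lemma integral_qExp_neg_norm_sq_pos (hq : 1 ≤ q)
    (hq2 : (q - 1) * (Module.finrank ℝ E + 2) < 2) :
    0 < ∫ x : E, qExp q (-‖x‖ ^ 2) ∂μ :=
  integral_pos_of_integrable_nonneg_nonzero (x := 0) (continuous_qExp_neg_norm_sq hq)
    (integrable_qExp_neg_norm_sq μ hq hq2) (fun _ => (qExp_neg_pos hq (sq_nonneg _)).le)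
    (qExp_neg_pos hq (sq_nonneg _)).ne'

lemma integral_norm_sq_mul_qExp_pos [Nontrivial E] (hq : 1 ≤ q)
    (hq2 : (q - 1) * (Module.finrank ℝ E + 2) < 2) :
    0 < ∫ x : E, ‖x‖ ^ 2 * qExp q (-‖x‖ ^ 2) ∂μ := by
  obtain ⟨v, hv⟩ := exists_ne (0 : E)
  exact integral_pos_of_integrable_nonneg_nonzero (x := v)
    (Continuous.mul (by fun_prop) (continuous_qExp_neg_norm_sq hq))
    (integrable_norm_sq_mul_qExp μ hq hq2)
    (fun x => mul_nonneg (sq_nonneg _) (qExp_neg_pos hq (sq_nonneg _)).le)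
    (mul_ne_zero (pow_ne_zero 2 (norm_ne_zero_iff.2 hv)) (qExp_neg_pos hq (sq_nonneg _)).ne')

end QExp

section RadialMoments

variable {ι : Type*} [Fintype ι]

lemma integral_comp_linearIsometryEquiv {E : Type*} [NormedAddCommGroup E]
    [InnerProductSpace ℝ E] [FiniteDimensional ℝ E] [MeasurableSpace E] [BorelSpace E]
    (e : E ≃ₗᵢ[ℝ] E) (f : E → ℝ) : ∫ x, f (e x) = ∫ x, f x :=
  e.measurePreserving.integral_comp e.toHomeomorph.measurableEmbedding f

lemma integral_radial_mul_coord_of_ne (g : ℝ → ℝ) {i j : ι} (hij : i ≠ j) :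
    ∫ x : EuclideanSpace ℝ ι, g ‖x‖ * (x i * x j) = 0 := by
  classical
  let e : EuclideanSpace ℝ ι ≃ₗᵢ[ℝ] EuclideanSpace ℝ ι :=
    LinearIsometryEquiv.piLpCongrRight 2
      fun k => if k = i then LinearIsometryEquiv.neg ℝ else LinearIsometryEquiv.refl ℝ ℝ
  have h := integral_comp_linearIsometryEquiv e fun x => g ‖x‖ * (x i * x j)
  have hi : ∀ x, e x i = -x i := fun x => by simp [e]
  have hj : ∀ x, e x j = x j := fun x => by simp [e, hij.symm]
  simp only [LinearIsometryEquiv.norm_map, hi, hj, neg_mul, mul_neg, integral_neg] at h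
  linarith

lemma integral_radial_mul_coord_self_eq (g : ℝ → ℝ) (i j : ι) :
    ∫ x : EuclideanSpace ℝ ι, g ‖x‖ * (x i * x i) =
      ∫ x : EuclideanSpace ℝ ι, g ‖x‖ * (x j * x j) := by
  classical
  let e : EuclideanSpace ℝ ι ≃ₗᵢ[ℝ] EuclideanSpace ℝ ι :=
    LinearIsometryEquiv.piLpCongrLeft 2 ℝ ℝ (Equiv.swap i j)
  have h := integral_comp_linearIsometryEquiv e fun x => g ‖x‖ * (x j * x j)
  have hj : ∀ x, e x j = x i := fun x => by
    simp [e, LinearIsometryEquiv.piLpCongrLeft_apply, Equiv.piCongrLeft']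
  simpa only [LinearIsometryEquiv.norm_map, hj] using h

lemma card_mul_integral_radial_mul_coord_self (g : ℝ → ℝ)
    (hg : Continuous fun x : EuclideanSpace ℝ ι => g ‖x‖)
    (hint : Integrable fun x : EuclideanSpace ℝ ι => g ‖x‖ * ‖x‖ ^ 2) (i : ι) :
    Fintype.card ι * ∫ x : EuclideanSpace ℝ ι, g ‖x‖ * (x i * x i) =
      ∫ x : EuclideanSpace ℝ ι, g ‖x‖ * ‖x‖ ^ 2 := by
  have hk : ∀ k : ι, Integrable fun x : EuclideanSpace ℝ ι => g ‖x‖ * (x k * x k) := by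
    refine fun k => hint.mono (hg.mul (by fun_prop)).aestronglyMeasurable
      (Filter.Eventually.of_forall fun x => ?_)
    rw [norm_mul, norm_mul, norm_mul, norm_pow, norm_norm, ← sq]
    gcongr
    exact PiLp.norm_apply_le x k
  calc (Fintype.card ι : ℝ) * ∫ x : EuclideanSpace ℝ ι, g ‖x‖ * (x i * x i)
      = ∑ k : ι, ∫ x : EuclideanSpace ℝ ι, g ‖x‖ * (x k * x k) := by
        rw [Finset.sum_congr rfl fun k _ => integral_radial_mul_coord_self_eq g k i]
        simp
    _ = ∫ x : EuclideanSpace ℝ ι, ∑ k : ι, g ‖x‖ * (x k * x k) :=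
        (integral_finsetSum _ fun k _ => hk k).symm
    _ = _ := by
        congr 1 with x
        rw [EuclideanSpace.real_norm_sq_eq, Finset.mul_sum]
        simp only [sq]

end RadialMoments

section QConstants

variable {q : ℝ} {d : ℕ}

lemma piQd_pos (hq : 1 ≤ q) (hq2 : (q - 1) * (d + 2) < 2) : 0 < piQd q d :=
  Real.rpow_pos_of_pos (integral_qExp_neg_norm_sq_pos _ hq (by simpa using hq2)) _

lemma integral_norm_sq_mul_qExp_euclidean_pos (hd : 1 ≤ d) (hq : 1 ≤ q)
    (hq2 : (q - 1) * (d + 2) < 2) :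
    0 < ∫ x : EuclideanSpace ℝ (Fin d), ‖x‖ ^ 2 * qExp q (-‖x‖ ^ 2) := by
  have : Nonempty (Fin d) := ⟨⟨0, hd⟩⟩
  exact integral_norm_sq_mul_qExp_pos _ hq (by simpa using hq2)

lemma twoQd_pos (hd : 1 ≤ d) (hq : 1 ≤ q) (hq2 : (q - 1) * (d + 2) < 2) : 0 < twoQd q d := by
  have h1 := piQd_pos hq hq2
  have h2 := integral_norm_sq_mul_qExp_euclidean_pos hd hq hq2
  have h3 : (0 : ℝ) < d := by exact_mod_cast hd
  unfold twoQd
  positivity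

/-- The second moments of a dilated `q`-exponential. -/
lemma integral_qExp_dilated_mul_coord (hd : 1 ≤ d) (hq : 1 ≤ q)
    (hq2 : (q - 1) * (d + 2) < 2) {c : ℝ} (hc : 0 < c) (i j : Fin d) :
    ∫ x : EuclideanSpace ℝ (Fin d), qExp q (-(c * ‖x‖ ^ 2)) * (x i * x j) =
      c ^ (-(((d : ℝ) + 2) / 2)) * (piQd q d ^ ((d : ℝ) / 2) / twoQd q d) *
        (1 : Matrix (Fin d) (Fin d) ℝ) i j := by
  have hJ := integral_norm_sq_mul_qExp_euclidean_pos hd hq hq2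
  have hπ := piQd_pos hq hq2
  have hd0 : (0 : ℝ) < d := by exact_mod_cast hd
  set b : ℝ := √c
  have hb : 0 < b := Real.sqrt_pos.2 hc
  have hbc : b ^ 2 = c := Real.sq_sqrt hc.le
  have hscale : ∀ x : EuclideanSpace ℝ (Fin d),
      qExp q (-(c * ‖x‖ ^ 2)) * (x i * x j) = c⁻¹ *
        (qExp q (-‖b • x‖ ^ 2) * ((b • x) i * (b • x) j)) := fun x => by
    rw [norm_smul, mul_pow, Real.norm_eq_abs, sq_abs, hbc]
    simp only [PiLp.smul_apply, smul_eq_mul]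
    rw [← hbc]
    field_simp
  simp only [hscale]
  rw [integral_const_mul, Measure.integral_comp_smul volume
    (fun x : EuclideanSpace ℝ (Fin d) => qExp q (-‖x‖ ^ 2) * (x i * x j))]
  have hpow : c⁻¹ * (b ^ d)⁻¹ = c ^ (-(((d : ℝ) + 2) / 2)) := by
    rw [← mul_inv, Real.rpow_neg hc.le]
    congr 1
    have : b ^ d = c ^ ((d : ℝ) / 2) := by
      rw [← Real.rpow_natCast, show b = c ^ (1 / 2 : ℝ) from Real.sqrt_eq_rpow c, ← Real.rpow_mul hc.le]
      congr 1; ring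
    rw [this, add_div, div_self two_ne_zero, Real.rpow_add hc, Real.rpow_one, mul_comm]
  rw [finrank_euclideanSpace_fin, abs_of_pos (by positivity), smul_eq_mul, ← mul_assoc, hpow,
    mul_assoc]
  congr 1
  by_cases hij : i = j
  · subst hij
    have hcard := card_mul_integral_radial_mul_coord_self (ι := Fin d)
      (fun r => qExp q (-r ^ 2)) (continuous_qExp_neg_norm_sq hq)
      (by
        simpa only [mul_comm] using integrable_norm_sq_mul_qExp volume hq
          (E := EuclideanSpace ℝ (Fin d)) (by simpa using hq2)) i
    have hcomm : ∫ x : EuclideanSpace ℝ (Fin d), qExp q (-‖x‖ ^ 2) * ‖x‖ ^ 2 =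
        ∫ x : EuclideanSpace ℝ (Fin d), ‖x‖ ^ 2 * qExp q (-‖x‖ ^ 2) := by
      simp only [mul_comm]
    rw [Fintype.card_fin, hcomm] at hcard
    have hp : piQd q d ^ ((d : ℝ) / 2) ≠ 0 := (Real.rpow_pos_of_pos hπ _).ne'
    rw [Matrix.one_apply_eq, mul_one, twoQd, ← hcard]
    rw [← hcard] at hJ
    have := (pos_of_mul_pos_right hJ hd0.le).ne'
    field_simp
  · rw [integral_radial_mul_coord_of_ne (fun r => qExp q (-r ^ 2)) hij,
      Matrix.one_apply_ne hij, mul_zero]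

end QConstants

/-- second escort-moment identity for the q-Gaussian: with
`s₂ = 1+2λ(q-1)` and `q' = [s₂-(1-q)]/s₂`,
`(2_{q'd}(2_{qd}π_{qd})^{λd(q-1)}/2_{qd}) (π_{qd}/π_{q'd})^{d/2} s₂^{(d+2)/2}
  ∫ G_q(x;0,I)^{s₂} x xᵀ dx = I_d`. -/
theorem stmt10 (d : ℕ) (hd : 1 ≤ d) (lam : ℝ) (hlam : 0 < lam) (q : ℝ)
    (hq1 : 1 ≤ q)
    (hq2 : q < min (((d : ℝ) * lam + 1) / ((d : ℝ) * lam)) (((d : ℝ) + 4) / ((d : ℝ) + 2)))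
    (s2 : ℝ) (hs2 : s2 = 1 + 2 * lam * (q - 1))
    (q' : ℝ) (hq' : q' = (s2 - (1 - q)) / s2)
    (M : Matrix (Fin d) (Fin d) ℝ)
    (hM : ∀ i j, M i j = ∫ x : EuclideanSpace ℝ (Fin d), GqId q d x ^ s2 * (x i * x j)) :
    (twoQd q' d * (twoQd q d * piQd q d) ^ (lam * (d : ℝ) * (q - 1)) / twoQd q d *
        (piQd q d / piQd q' d) ^ ((d : ℝ) / 2) * s2 ^ (((d : ℝ) + 2) / 2)) • M =
      (1 : Matrix (Fin d) (Fin d) ℝ) := by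
  have hd0 : (0 : ℝ) < d := by exact_mod_cast hd
  have hq2 : (q - 1) * (d + 2) < 2 := by
    have h := (lt_min_iff.1 hq2).2
    rw [lt_div_iff₀ (by positivity)] at h
    linarith
  have h0 : 0 ≤ q - 1 := by linarith
  have hs1 : 1 ≤ s2 := by
    have : 0 ≤ 2 * lam * (q - 1) := by positivity
    linarith
  have hs : 0 < s2 := by linarith
  have hq'' : q' = 1 + (q - 1) / s2 := by rw [hq']; field_simp; ring
  have hq'1 : 1 ≤ q' := by
    have : 0 ≤ (q - 1) / s2 := by positivity
    linarith
  have hq'2 : (q' - 1) * (d + 2) < 2 := by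
    have : q' - 1 ≤ q - 1 := by
      rw [hq'', add_sub_cancel_left]; exact div_le_self h0 hs1
    nlinarith
  have hT := twoQd_pos hd hq1 hq2
  have hP := piQd_pos hq1 hq2
  have hT' := twoQd_pos hd hq'1 hq'2
  have hP' := piQd_pos hq'1 hq'2
  have hG : ∀ x, GqId q d x ^ s2 =
      ((twoQd q d * piQd q d) ^ ((d : ℝ) / 2 * s2))⁻¹ *
        qExp q' (-(s2 / twoQd q d * ‖x‖ ^ 2)) := fun x => by
    have hy : 0 ≤ ‖x‖ ^ 2 / twoQd q d := by positivity
    rw [GqId, Real.div_rpow (qExp_neg_pos hq1 hy).le (by positivity), qExp_neg_rpow hq1 hs hy,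
      ← Real.rpow_mul (by positivity), ← hq'', div_eq_inv_mul (qExp _ _),
      mul_div_assoc', div_mul_eq_mul_div s2]
  ext i j
  rw [Matrix.smul_apply, hM, smul_eq_mul]
  simp only [hG, mul_assoc (((twoQd q d * piQd q d) ^ ((d : ℝ) / 2 * s2))⁻¹)]
  rw [integral_const_mul, integral_qExp_dilated_mul_coord hd hq'1 hq'2 (by positivity),
    ← mul_assoc, ← mul_assoc]
  convert one_mul _ using 2
  have e : (d : ℝ) / 2 * s2 = (d : ℝ) / 2 + lam * d * (q - 1) := by rw [hs2]; ring
  rw [e, Real.rpow_add (by positivity), Real.mul_rpow hT.le hP.le (z := (d : ℝ) / 2),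
    Real.div_rpow hP.le hP'.le, Real.rpow_neg (by positivity), Real.div_rpow hs.le hT.le,
    add_div, div_self two_ne_zero, Real.rpow_add hT, Real.rpow_one]
  field_simp
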